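/- arXiv:1905.05413 — 3 statements merged into one kernel-verified Lean document; each statement's English description precedes it below -/
import Mathlib

section
/- Let β > 1 and let f ∈ S*_R. If β ≥ 2, then Re(zf'(z)/f(z)) < β for all z ∈ 𝔻. If 1 < β ≤ 2, then Re(zf'(z)/f(z)) < β for all z with |z| < k(−β + √(β² + 4β − 4))/2, where k = √2 + 1. -/
open Metric Set Complex

noncomputable section

/-- The class 𝒜 of analytic functions on the unit disk normalized by f(0)=0, f'(0)=1. -/
def InClassA (f : ℂ → ℂ) : Prop :=
  AnalyticOnNhd ℂ f (ball 0 1) ∧ f 0 = 0 ∧ deriv f 0 = 1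

/-- Membership in the Ma-Minda type class S*(φ): f ∈ 𝒜 and zf'(z)/f(z) ≺ φ(z),
witnessed by a Schwarz function w. -/
def MemStar (φ : ℂ → ℂ) (f : ℂ → ℂ) : Prop :=
  InClassA f ∧ ∃ w : ℂ → ℂ, AnalyticOnNhd ℂ w (ball 0 1) ∧ w 0 = 0 ∧
    (∀ z ∈ ball (0:ℂ) 1, ‖w z‖ < 1) ∧
    (∀ z ∈ ball (0:ℂ) 1, z ≠ 0 → z * deriv f z / f z = φ (w z))

/-- Ma-Minda superordinate function: analytic, univalent on 𝔻, positive real part,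
φ(0) = 1, real coefficients (symmetric image w.r.t. the real axis), image starlike
with respect to 1, and φ'(0) > 0. -/
def IsMaMinda (φ : ℂ → ℂ) : Prop :=
  AnalyticOnNhd ℂ φ (ball 0 1) ∧ Set.InjOn φ (ball 0 1) ∧
  (∀ z ∈ ball (0:ℂ) 1, 0 < (φ z).re) ∧ φ 0 = 1 ∧
  (∀ z ∈ ball (0:ℂ) 1, (starRingEnd ℂ) (φ z) = φ ((starRingEnd ℂ) z)) ∧
  (∀ z ∈ ball (0:ℂ) 1, ∀ t : ℝ, 0 ≤ t → t ≤ 1 → 1 + (t : ℂ) * (φ z - 1) ∈ φ '' (ball 0 1)) ∧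
  0 < (deriv φ 0).re ∧ (deriv φ 0).im = 0

/-- n-th Taylor coefficient at the origin. -/
def taylorCoeff (g : ℂ → ℂ) (n : ℕ) : ℂ := iteratedDeriv n g 0 / n.factorial

/-- k = √2 + 1. -/
def kR : ℝ := Real.sqrt 2 + 1

/-- The rational superordinate function φ_R(z) = 1 + (z/k)(k+z)/(k-z) with k = √2+1. -/
def phiR : ℂ → ℂ := fun z => 1 + (z / (kR : ℂ)) * (((kR : ℂ) + z) / ((kR : ℂ) - z))

lemma kR_pos : 0 < kR := by unfold kR; positivity

/-- For `‖z‖ < k`, `Re φ_R(z) < β` as soon as `φ_R(‖z‖) < β`, here with denominators cleared. -/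
lemma re_phiR_lt {β : ℝ} {z : ℂ} (hz : ‖z‖ / kR < 1)
    (h : 1 + (‖z‖ / kR) ^ 2 < β * (1 - ‖z‖ / kR)) : (phiR z).re < β := by
  have hk := kR_pos
  have hzk : ‖z‖ < kR := by rwa [div_lt_one hk] at hz
  have hkn : ‖(kR : ℂ)‖ = kR := by rw [Complex.norm_real, Real.norm_of_nonneg hk.le]
  have hnum : ‖(kR : ℂ) + z‖ ≤ kR + ‖z‖ := by simpa only [hkn] using norm_add_le (kR : ℂ) z
  have hden : kR - ‖z‖ ≤ ‖(kR : ℂ) - z‖ := by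
    simpa only [hkn] using norm_sub_norm_le (kR : ℂ) z
  have hpos : 0 < kR - ‖z‖ := sub_pos.2 hzk
  have hnorm : ‖z / (kR : ℂ) * (((kR : ℂ) + z) / ((kR : ℂ) - z))‖
      ≤ ‖z‖ / kR * ((kR + ‖z‖) / (kR - ‖z‖)) := by
    rw [norm_mul, norm_div, norm_div, hkn]
    gcongr
  have hlt : 1 + ‖z‖ / kR * ((kR + ‖z‖) / (kR - ‖z‖)) < β := by
    have heq : 1 + ‖z‖ / kR * ((kR + ‖z‖) / (kR - ‖z‖))
        = (1 + (‖z‖ / kR) ^ 2) / (1 - ‖z‖ / kR) := by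
      have : 1 - ‖z‖ / kR ≠ 0 := (sub_pos.2 hz).ne'
      field_simp
      ring
    rwa [heq, div_lt_iff₀ (sub_pos.2 hz)]
  have hre := (Complex.re_le_norm (z / (kR : ℂ) * (((kR : ℂ) + z) / ((kR : ℂ) - z)))).trans hnorm
  rw [phiR, Complex.add_re, Complex.one_re]
  linarith

/-- If `t` lies to the left of the positive root of `t ^ 2 + β * t + (1 - β)`, the quadratic is
negative at `t`. -/
lemma one_add_sq_lt {β t : ℝ} (hβ : 1 < β) (ht : 0 ≤ t)
    (h : t < (-β + Real.sqrt (β ^ 2 + 4 * β - 4)) / 2) : 1 + t ^ 2 < β * (1 - t) := by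
  have hD : 2 * t + β < Real.sqrt (β ^ 2 + 4 * β - 4) := by linarith
  have := (Real.lt_sqrt (by linarith)).1 hD
  nlinarith

lemma kR_mul_root_two : kR * (-2 + Real.sqrt (2 ^ 2 + 4 * 2 - 4)) / 2 = 1 := by
  have h8 : Real.sqrt (2 ^ 2 + 4 * 2 - 4) = 2 * Real.sqrt 2 := by
    rw [show (2 ^ 2 + 4 * 2 - 4 : ℝ) = 2 ^ 2 * 2 by norm_num,
      Real.sqrt_mul (by norm_num), Real.sqrt_sq (by norm_num)]
  have h2 : Real.sqrt 2 ^ 2 = 2 := Real.sq_sqrt (by norm_num)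
  rw [h8, kR]
  linear_combination h2

lemma root_le_root_two {β : ℝ} (hβ : 1 < β) (hβ2 : β ≤ 2) :
    kR * (-β + Real.sqrt (β ^ 2 + 4 * β - 4)) / 2 ≤ 1 := by
  have hk := kR_pos
  rw [← kR_mul_root_two]
  have hs : Real.sqrt (2 ^ 2 + 4 * 2 - 4) ≥ 2 := Real.le_sqrt_of_sq_le (by norm_num)
  have hs2 : Real.sqrt (2 ^ 2 + 4 * 2 - 4) ^ 2 = 8 := by
    rw [Real.sq_sqrt (by norm_num)]; norm_num
  have hsβ : Real.sqrt (β ^ 2 + 4 * β - 4) ≤ Real.sqrt (2 ^ 2 + 4 * 2 - 4) - (2 - β) := by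
    have h3 : Real.sqrt (2 ^ 2 + 4 * 2 - 4) ≤ 3 := Real.sqrt_le_iff.2 (by norm_num)
    refine Real.sqrt_le_iff.2 ⟨by linarith, ?_⟩
    nlinarith
  have hroot : -β + Real.sqrt (β ^ 2 + 4 * β - 4) ≤ -2 + Real.sqrt (2 ^ 2 + 4 * 2 - 4) := by
    linarith
  exact div_le_div_of_nonneg_right (mul_le_mul_of_nonneg_left hroot hk.le) zero_le_two

/-- The real part of `z f'(z) / f(z)` is less than `β` at every point of the unit disk where
`φ_R(‖z‖) < β`. -/
lemma MemStar.re_lt {β : ℝ} (hβ : 1 < β) {f : ℂ → ℂ} (hf : MemStar phiR f) {z : ℂ}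
    (hz : z ∈ ball (0 : ℂ) 1) (h : 1 + (‖z‖ / kR) ^ 2 < β * (1 - ‖z‖ / kR)) :
    (z * deriv f z / f z).re < β := by
  obtain ⟨-, w, hw, hw0, hwlt, hwf⟩ := hf
  have hk := kR_pos
  rcases eq_or_ne z 0 with rfl | hz0
  · simp only [zero_mul, zero_div, Complex.zero_re]
    linarith
  have hle : ‖w z‖ ≤ ‖z‖ :=
    Complex.norm_le_norm_of_mapsTo_ball hw.differentiableOn
      (fun x hx => mem_closedBall_zero_iff.2 (hwlt x hx).le) hw0 (mem_ball_zero_iff.1 hz)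
  have hzk : ‖z‖ / kR < 1 := by
    by_contra! hcon
    nlinarith [sq_nonneg (‖z‖ / kR)]
  have hdiv : ‖w z‖ / kR ≤ ‖z‖ / kR := by gcongr
  have h0 : 0 ≤ ‖w z‖ / kR := by positivity
  rw [hwf z hz hz0]
  refine re_phiR_lt (hdiv.trans_lt hzk) ?_
  nlinarith

theorem stmt_17 (β : ℝ) (hβ : 1 < β) (f : ℂ → ℂ) (hf : MemStar phiR f) :
    (2 ≤ β → ∀ z ∈ ball (0:ℂ) 1, (z * deriv f z / f z).re < β) ∧
    (β ≤ 2 → ∀ z : ℂ, ‖z‖ < kR * (-β + Real.sqrt (β ^ 2 + 4 * β - 4)) / 2 →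
      (z * deriv f z / f z).re < β) := by
  have main {b : ℝ} (hb : 1 < b) (hb2 : b ≤ 2) {z : ℂ}
      (hz : ‖z‖ < kR * (-b + Real.sqrt (b ^ 2 + 4 * b - 4)) / 2) :
      (z * deriv f z / f z).re < b := by
    refine hf.re_lt hb (mem_ball_zero_iff.2 (hz.trans_le (root_le_root_two hb hb2)))
      (one_add_sq_lt hb (div_nonneg (norm_nonneg z) kR_pos.le) ?_)
    rw [div_lt_iff₀ kR_pos]
    linarith
  refine ⟨fun h2 z hz => (main one_lt_two le_rfl ?_).trans_le h2, fun h2 z => main hβ h2⟩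
  rw [kR_mul_root_two]
  exact mem_ball_zero_iff.1 hz
end
end

section
/- Let f ∈ S*_R and let R = (k − 2ek + k·√(1 − 8e + 8e²))/(2e), where k = √2 + 1 and e = exp(1). Then for every r with 0 < r ≤ R, the function z ↦ f(rz)/r belongs to S*_e. -/
open Metric Set Complex

noncomputable section

lemma norm_log_one_add_le_neg_log {x : ℂ} (hx : ‖x‖ < 1) :
    ‖Complex.log (1 + x)‖ ≤ -Real.log (1 - ‖x‖) := by
  have hR := Real.hasSum_pow_div_log_of_abs_lt_one (x := ‖x‖) (by simpa using hx)
  have hC := Complex.hasSum_taylorSeries_neg_log (z := -x) (by simpa using hx)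
  rw [sub_neg_eq_add] at hC
  have hC' := (hasSum_nat_add_iff' 1).mpr hC
  simp only [Finset.range_one, Finset.sum_singleton, Nat.cast_zero, div_zero, sub_zero] at hC'
  rw [← norm_neg, ← hC'.tsum_eq]
  refine tsum_of_norm_bounded hR fun n => ?_
  rw [norm_div, norm_pow, norm_neg, Complex.norm_natCast]
  push_cast
  exact le_rfl

lemma phiR_radius_quadratic {R : ℝ}
    (hR : R = (kR - 2 * Real.exp 1 * kR
        + kR * Real.sqrt (1 - 8 * Real.exp 1 + 8 * (Real.exp 1) ^ 2)) / (2 * Real.exp 1)) :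
    Real.exp 1 * (R / kR) ^ 2 + (2 * Real.exp 1 - 1) * (R / kR) = Real.exp 1 - 1 ∧
      R / kR < 2 / 5 := by
  have he1 := Real.exp_one_gt_d9
  have he2 := Real.exp_one_lt_d9
  have hk := kR_pos
  generalize Real.exp 1 = e at *
  have hs := Real.sq_sqrt (show (0 : ℝ) ≤ 1 - 8 * e + 8 * e ^ 2 by nlinarith)
  have hs0 := Real.sqrt_nonneg (1 - 8 * e + 8 * e ^ 2)
  generalize √(1 - 8 * e + 8 * e ^ 2) = s at *
  have he : 0 < e := by linarith
  have hρ : R / kR = (1 - 2 * e + s) / (2 * e) := by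
    rw [hR]
    field_simp
  rw [hρ]
  constructor
  · field_simp
    linear_combination hs
  · rw [div_lt_iff₀ (by positivity)]
    have : s < 14 / 5 * e - 1 := by
      apply lt_of_pow_lt_pow_left₀ 2 (by linarith)
      rw [hs]
      nlinarith
    linarith

lemma norm_phiR_sub_one_lt {R : ℝ}
    (hR : R = (kR - 2 * Real.exp 1 * kR
        + kR * Real.sqrt (1 - 8 * Real.exp 1 + 8 * (Real.exp 1) ^ 2)) / (2 * Real.exp 1))
    {v : ℂ} (hv : ‖v‖ < R) : ‖phiR v - 1‖ < 1 - Real.exp (-1) := by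
  obtain ⟨hq, hlt⟩ := phiR_radius_quadratic hR
  have hk := kR_pos
  have hk' : (kR : ℂ) ≠ 0 := by exact_mod_cast hk.ne'
  have he1 := Real.exp_one_gt_d9
  set u : ℂ := v / kR with hu
  have hun : ‖u‖ < R / kR := by
    rw [hu, norm_div, Complex.norm_real, Real.norm_of_nonneg hk.le]
    gcongr
  have hphi : phiR v - 1 = u * (1 + u) / (1 - u) := by
    have h1 : (kR : ℂ) + v = kR * (1 + u) := by rw [hu]; field_simp
    have h2 : (kR : ℂ) - v = kR * (1 - u) := by rw [hu]; field_simp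
    unfold phiR
    rw [h1, h2, mul_div_mul_left _ _ hk', ← hu]
    ring
  have ht := norm_nonneg u
  have hadd : ‖1 + u‖ ≤ 1 + ‖u‖ := by simpa using norm_add_le 1 u
  have hsub : 1 - ‖u‖ ≤ ‖1 - u‖ := by simpa using norm_sub_norm_le 1 u
  have hpos : 0 < 1 - ‖u‖ := by linarith
  rw [hphi, norm_div, norm_mul, Real.exp_neg]
  calc ‖u‖ * ‖1 + u‖ / ‖1 - u‖ ≤ ‖u‖ * (1 + ‖u‖) / (1 - ‖u‖) := by gcongr
    _ < 1 - (Real.exp 1)⁻¹ := by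
      generalize Real.exp 1 = e at *
      have he : 0 < e := by linarith
      have hei : 1 - e⁻¹ = (e - 1) / e := by field_simp
      rw [hei, div_lt_div_iff₀ hpos he]
      nlinarith [mul_pos he (sub_pos.mpr hun)]

theorem stmt_18 (f : ℂ → ℂ) (hf : MemStar phiR f) (R : ℝ)
    (hR : R = (kR - 2 * Real.exp 1 * kR
        + kR * Real.sqrt (1 - 8 * Real.exp 1 + 8 * (Real.exp 1) ^ 2)) / (2 * Real.exp 1)) :
    ∀ r : ℝ, 0 < r → r ≤ R →
      MemStar (fun z => Complex.exp z) (fun z => f ((r : ℂ) * z) / (r : ℂ)) := by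
  intro r hr hrR
  obtain ⟨⟨hfa, hf0, hf1⟩, w, hwa, hw0, hw1, hfw⟩ := hf
  have hk := kR_pos
  have hR1 : R < 1 := by
    have h := (phiR_radius_quadratic hR).2
    rw [div_lt_iff₀ hk] at h
    have h2 : √2 < 3 / 2 := by
      rw [Real.sqrt_lt' (by norm_num)]
      norm_num
    unfold kR at h
    linarith
  have hrc : (r : ℂ) ≠ 0 := by exact_mod_cast hr.ne'
  have hnorm : ∀ z ∈ ball (0 : ℂ) 1, ‖(r : ℂ) * z‖ < r := by
    intro z hz
    rw [mem_ball_zero_iff] at hz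
    rw [norm_mul, Complex.norm_real, Real.norm_of_nonneg hr.le]
    nlinarith
  have hmaps : MapsTo (fun z : ℂ => (r : ℂ) * z) (ball 0 1) (ball 0 1) := by
    intro z hz
    rw [mem_ball_zero_iff]
    linarith [hnorm z hz]
  have hlin : AnalyticOnNhd ℂ (fun z : ℂ => (r : ℂ) * z) (ball 0 1) :=
    analyticOnNhd_const.mul analyticOnNhd_id
  have hderiv : ∀ z, deriv (fun z => f ((r : ℂ) * z) / (r : ℂ)) z = deriv f (r * z) := by
    intro z
    rw [deriv_div_const, deriv_comp_mul_left, smul_eq_mul]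
    field_simp
  have hschwarz : ∀ z ∈ ball (0 : ℂ) 1, ‖w z‖ ≤ ‖z‖ := fun z hz =>
    Complex.norm_le_norm_of_mapsTo_ball hwa.differentiableOn
      (fun y hy => mem_closedBall_zero_iff.mpr (hw1 y hy).le) hw0 (mem_ball_zero_iff.mp hz)
  have hbound : ∀ z ∈ ball (0 : ℂ) 1, ‖phiR (w (r * z)) - 1‖ < 1 - Real.exp (-1) :=
    fun z hz => norm_phiR_sub_one_lt hR <|
      (hschwarz _ (hmaps hz)).trans_lt ((hnorm z hz).trans_le hrR)
  have hslit : ∀ z ∈ ball (0 : ℂ) 1, phiR (w (r * z)) ∈ slitPlane := by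
    intro z hz
    have h := Complex.mem_slitPlane_of_norm_lt_one
      ((hbound z hz).trans (by linarith [Real.exp_pos (-1)]))
    rwa [add_sub_cancel] at h
  have hwr : AnalyticOnNhd ℂ (fun z => w (r * z)) (ball 0 1) := hwa.comp hlin hmaps
  have hphi : AnalyticOnNhd ℂ (fun z => phiR (w (r * z))) (ball 0 1) := by
    intro z hz
    have hkw : (kR : ℂ) - w (r * z) ≠ 0 := by
      intro h
      have h1 := hw1 _ (hmaps hz)
      rw [← sub_eq_zero.mp h, Complex.norm_real, Real.norm_of_nonneg hk.le] at h1
      unfold kR at h1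
      linarith [Real.sqrt_nonneg 2]
    have hw := hwr z hz
    exact analyticAt_const.add <| hw.div_const.mul <|
      (analyticAt_const.add hw).div (analyticAt_const.sub hw) hkw
  refine ⟨⟨?_, by simp [hf0], by simp [hderiv, hf1]⟩,
    fun z => Complex.log (phiR (w (r * z))), fun z hz => (hphi z hz).clog (hslit z hz),
    by simp [hw0, phiR], ?_, ?_⟩
  · exact fun z hz => ((hfa.comp hlin hmaps) z hz).div_const
  · intro z hz
    have hb := hbound z hz
    have h := norm_log_one_add_le_neg_log (hb.trans (by linarith [Real.exp_pos (-1)]))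
    rw [add_sub_cancel] at h
    have h2 : -1 < Real.log (1 - ‖phiR (w (r * z)) - 1‖) := by
      rw [Real.lt_log_iff_exp_lt (by linarith [Real.exp_pos (-1)])]
      linarith
    linarith
  · intro z hz hz0
    have h := hfw _ (hmaps hz) (mul_ne_zero hrc hz0)
    simp only [hderiv]
    rw [Complex.exp_log (slitPlane_ne_zero (hslit z hz)), ← h, div_div_eq_mul_div]
    ring
end
end

section
/- Fix 0 < α < 1 and let R = (−e + √(e² + 4(e − 1)²α))/(2α(e − 1)), where e = exp(1). If f ∈ BS*(α), then for every r with 0 < r ≤ R, the function z ↦ f(rz)/r belongs to S*_e. -/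
open Metric Set Complex

noncomputable section

lemma norm_log_one_add_le_neg_log_one_sub {z : ℂ} (hz : ‖z‖ < 1) :
    ‖Complex.log (1 + z)‖ ≤ -Real.log (1 - ‖z‖) := by
  have hs := Complex.hasSum_taylorSeries_neg_log' (z := -z) (by simpa using hz)
  have hr := Real.hasSum_pow_div_log_of_abs_lt_one (x := ‖z‖) (by simpa using hz)
  have h := hs.norm_le_of_bounded hr fun n => by
    have hn : ‖(n : ℂ) + 1‖ = n + 1 := by exact_mod_cast Complex.norm_natCast (n + 1)
    rw [norm_div, norm_pow, norm_neg, hn]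
  simpa using h

lemma norm_log_one_add_lt_one {z : ℂ} (hz : ‖z‖ < 1 - Real.exp (-1)) :
    ‖Complex.log (1 + z)‖ < 1 := by
  have he := Real.exp_pos (-1)
  refine (norm_log_one_add_le_neg_log_one_sub (by linarith)).trans_lt ?_
  rw [neg_lt, Real.lt_log_iff_exp_lt] <;> linarith

/-- The number `R` is the root of `R / (1 - α R ^ 2) = 1 - exp (-1)`. -/
lemma radius_eq {α R : ℝ} (hα : 0 < α)
    (hR : R = (-Real.exp 1 + Real.sqrt ((Real.exp 1) ^ 2 + 4 * (Real.exp 1 - 1) ^ 2 * α)) /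
        (2 * α * (Real.exp 1 - 1))) :
    R = (1 - Real.exp (-1)) * (1 - α * R ^ 2) := by
  have he : 1 < Real.exp 1 := Real.one_lt_exp_iff.mpr one_pos
  have hsq := Real.sq_sqrt (x := (Real.exp 1) ^ 2 + 4 * (Real.exp 1 - 1) ^ 2 * α) (by positivity)
  have hpos : 0 < Real.exp 1 - 1 := by linarith
  rw [eq_div_iff (by positivity)] at hR
  rw [show Real.sqrt ((Real.exp 1) ^ 2 + 4 * (Real.exp 1 - 1) ^ 2 * α) =
    R * (2 * α * (Real.exp 1 - 1)) + Real.exp 1 by linarith] at hsq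
  have hquad : α * (Real.exp 1 - 1) * R ^ 2 + Real.exp 1 * R = Real.exp 1 - 1 := by
    apply mul_left_cancel₀ (show 4 * α * (Real.exp 1 - 1) ≠ 0 by positivity)
    linear_combination hsq
  rw [Real.exp_neg]
  field_simp
  linear_combination hquad

lemma norm_div_one_sub_mul_sq_lt {α R c : ℝ} {v : ℂ} (hα0 : 0 ≤ α) (hc : 0 < c)
    (hRc : R = c * (1 - α * R ^ 2)) (hv : ‖v‖ < R) :
    1 - (α : ℂ) * v ^ 2 ≠ 0 ∧ ‖v / (1 - (α : ℂ) * v ^ 2)‖ < c := by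
  have hv0 := norm_nonneg v
  have hsq : ‖v‖ ^ 2 ≤ R ^ 2 := by gcongr
  have hlow : 1 - α * R ^ 2 ≤ ‖1 - (α : ℂ) * v ^ 2‖ := by
    have h := norm_sub_norm_le (1 : ℂ) ((α : ℂ) * v ^ 2)
    rw [norm_one, norm_mul, norm_pow, Complex.norm_real, Real.norm_of_nonneg hα0] at h
    nlinarith
  have hpos : 0 < ‖1 - (α : ℂ) * v ^ 2‖ := by nlinarith
  refine ⟨norm_pos_iff.mp hpos, ?_⟩
  rw [norm_div, div_lt_iff₀ hpos]
  nlinarith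

lemma InClassA.dilation {f : ℂ → ℂ} (hf : InClassA f) {r : ℝ} (hr0 : 0 < r) (hr1 : r ≤ 1) :
    InClassA fun z => f ((r : ℂ) * z) / (r : ℂ) := by
  obtain ⟨hfa, hf0, hf1⟩ := hf
  have hrC : (r : ℂ) ≠ 0 := by exact_mod_cast hr0.ne'
  refine ⟨fun z hz => ?_, by simp [hf0], ?_⟩
  · have hmem : (r : ℂ) * z ∈ ball (0 : ℂ) 1 := by
      rw [mem_ball_zero_iff] at hz ⊢
      rw [norm_mul, Complex.norm_real, Real.norm_of_nonneg hr0.le]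
      nlinarith [norm_nonneg z]
    exact ((hfa _ hmem).fun_comp (analyticAt_const.mul analyticAt_id)).div analyticAt_const hrC
  · rw [deriv_div_const, deriv_comp_mul_left]
    simp [hf1, hrC]

theorem stmt_19 (α : ℝ) (hα0 : 0 < α) (hα1 : α < 1) (f : ℂ → ℂ)
    (hf : MemStar (fun z => 1 + z / (1 - (α : ℂ) * z ^ 2)) f) (R : ℝ)
    (hR : R = (-Real.exp 1 + Real.sqrt ((Real.exp 1) ^ 2 + 4 * (Real.exp 1 - 1) ^ 2 * α)) /
        (2 * α * (Real.exp 1 - 1))) :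
    ∀ r : ℝ, 0 < r → r ≤ R →
      MemStar (fun z => Complex.exp z) (fun z => f ((r : ℂ) * z) / (r : ℂ)) := by
  intro r hr0 hrR
  obtain ⟨hfA, w, hwa, hw0, hwlt, hw⟩ := hf
  have hc0 : 0 < 1 - Real.exp (-1) := by simp
  have hRc := radius_eq hα0 hR
  have hR1 : R < 1 := by
    have := Real.exp_pos (-1)
    have : 0 < R := hr0.trans_le hrR
    nlinarith [mul_pos hc0 (mul_pos hα0 (pow_pos this 2))]
  have hrC : (r : ℂ) ≠ 0 := by exact_mod_cast hr0.ne'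
  have hnorm (z : ℂ) : ‖(r : ℂ) * z‖ = r * ‖z‖ := by
    rw [norm_mul, Complex.norm_real, Real.norm_of_nonneg hr0.le]
  have hmem (z : ℂ) (hz : z ∈ ball (0 : ℂ) 1) : (r : ℂ) * z ∈ ball (0 : ℂ) 1 := by
    rw [mem_ball_zero_iff] at hz ⊢
    rw [hnorm]
    nlinarith [norm_nonneg z]
  have hbound (z : ℂ) (hz : z ∈ ball (0 : ℂ) 1) := by
    refine norm_div_one_sub_mul_sq_lt (v := w (r * z)) hα0.le hc0 hRc ?_
    have hschwarz : ‖w (r * z)‖ ≤ ‖(r : ℂ) * z‖ :=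
      norm_le_norm_of_mapsTo_ball hwa.differentiableOn
        (fun x hx => mem_closedBall_zero_iff.mpr (hwlt x hx).le) hw0
        (mem_ball_zero_iff.mp (hmem z hz))
    rw [hnorm] at hschwarz
    rw [mem_ball_zero_iff] at hz
    nlinarith
  have hslit (z : ℂ) (hz : z ∈ ball (0 : ℂ) 1) :
      1 + w (r * z) / (1 - (α : ℂ) * w (r * z) ^ 2) ∈ slitPlane :=
    mem_slitPlane_of_norm_lt_one ((hbound z hz).2.trans (by simp [Real.exp_pos]))
  refine ⟨hfA.dilation hr0 (hrR.trans hR1.le),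
    fun z => Complex.log (1 + w (r * z) / (1 - (α : ℂ) * w (r * z) ^ 2)),
    fun z hz => ?_, by simp [hw0], fun z hz => norm_log_one_add_lt_one (hbound z hz).2,
    fun z hz hz0 => ?_⟩
  · have hwr : AnalyticAt ℂ (fun z => w (r * z)) z :=
      (hwa _ (hmem z hz)).fun_comp (analyticAt_const.mul analyticAt_id)
    exact (analyticAt_const.add (hwr.div
      (analyticAt_const.sub (analyticAt_const.mul (hwr.pow 2))) (hbound z hz).1)).clog (hslit z hz)
  · beta_reduce at hw ⊢
    rw [Complex.exp_log (slitPlane_ne_zero (hslit z hz)),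
      ← hw _ (hmem z hz) (mul_ne_zero hrC hz0), deriv_div_const, deriv_comp_mul_left, smul_eq_mul]
    field_simp
end
end
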